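/- Let A be a Noetherian integral domain and R a Noetherian commutative ring containing A as a subring, such that R is a formally smooth A-algebra and essentially of finite type over A. Let F be a finitely generated free R-module and p a prime ideal of R with p ∩ A = 0. Then for every p-primary R-submodule U of F there exists an (R ⊗_A R)-submodule E ⊆ Diff_{R/A}(F, R) such that U = {f ∈ F | δ(f) ∈ p for all δ ∈ E}, and E is finitely generated as an R-module via the left (post-composition) module structure. -/

import Mathlib

set_option linter.unusedSectionVars false

open scoped TensorProduct

namespace NoetherianOps

universe u v

section DiffOps

variable (A R M N : Type*) [CommRing A] [CommRing R] [Algebra A R]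
  [AddCommGroup M] [Module A M] [Module R M] [IsScalarTower A R M]
  [AddCommGroup N] [Module A N] [Module R N] [IsScalarTower A R N]

/-- Pre-composition of an `A`-linear map `δ : M →ₗ[A] N` with scalar multiplication by `r : R`,
i.e. the map `m ↦ δ (r • m)`. -/
def preSMul (r : R) (δ : M →ₗ[A] N) : M →ₗ[A] N :=
  δ.comp (r • (LinearMap.id : M →ₗ[A] M))

@[simp] lemma preSMul_apply (r : R) (δ : M →ₗ[A] N) (m : M) :
    preSMul A R M N r δ m = δ (r • m) := rfl

/-- The bracket `[δ, r] : m ↦ δ (r • m) - r • δ m` of an `A`-linear map `δ : M →ₗ[A] N`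
with multiplication by `r : R`. -/
def opBracket (r : R) (δ : M →ₗ[A] N) : M →ₗ[A] N :=
  preSMul A R M N r δ - r • δ

@[simp] lemma opBracket_apply (r : R) (δ : M →ₗ[A] N) (m : M) :
    opBracket A R M N r δ m = δ (r • m) - r • δ m := rfl

/-- `DiffLE A R M N n` is the set of `A`-linear differential operators `M → N` of order
at most `n`: an operator has order `≤ 0` iff all brackets `[δ, r]` vanish (i.e. `δ` is
`R`-linear), and order `≤ n + 1` iff all brackets `[δ, r]` have order `≤ n`.  This matches
the inductive definition `Diff⁻¹ = 0`, `Diffⁿ = {δ ∣ [δ, r] ∈ Diffⁿ⁻¹ for all r ∈ R}`. -/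
def DiffLE : ℕ → Set (M →ₗ[A] N)
  | 0 => {δ | ∀ r : R, opBracket A R M N r δ = 0}
  | n + 1 => {δ | ∀ r : R, opBracket A R M N r δ ∈ DiffLE n}

/-- `Diff A R M N` is the set of all `A`-linear differential operators from `M` to `N`,
i.e. the union of the `DiffLE A R M N n` over all `n`. -/
def Diff : Set (M →ₗ[A] N) := {δ | ∃ n : ℕ, δ ∈ DiffLE A R M N n}

/-- A subset `E ⊆ Hom_A(M, N)` is an `(R ⊗[A] R)`-submodule iff it is an additive subgroup
closed under the two `R`-actions `δ ↦ r • δ` (post-composition, the action of `r ⊗ 1`) and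
`δ ↦ δ ∘ (r • ·)` (pre-composition, the action of `1 ⊗ r`); simple tensors generate
`R ⊗[A] R`, so this is exactly the condition of being an `(R ⊗[A] R)`-submodule for the
module structure `((r ⊗ s) • δ) (m) = r • δ (s • m)`. -/
def IsTensorSubmodule (E : Set (M →ₗ[A] N)) : Prop :=
  (0 : M →ₗ[A] N) ∈ E ∧
  (∀ δ ∈ E, ∀ ε ∈ E, δ + ε ∈ E) ∧
  (∀ δ ∈ E, -δ ∈ E) ∧
  (∀ (r : R), ∀ δ ∈ E, r • δ ∈ E) ∧
  (∀ (r : R), ∀ δ ∈ E, preSMul A R M N r δ ∈ E)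

end DiffOps

/-- The solution set of a family `E` of operators `M → N`: the set of `m ∈ M` killed by
every member of `E`. -/
def Sol {A M N : Type*} [CommRing A] [AddCommGroup M] [Module A M]
    [AddCommGroup N] [Module A N] (E : Set (M →ₗ[A] N)) : Set M :=
  {m | ∀ δ ∈ E, δ m = 0}

/-- `E` is finitely generated via the left (post-composition) `R'`-module structure on
`Hom_A(M, N)`: there is a finite subset of `E` such that every element of `E` is an
`R'`-linear combination (for the action `(r • δ) m = r • δ m`) of its members. -/
def IsFGLeft {A M N : Type*} (R' : Type*) [CommRing A] [CommRing R']
    [AddCommGroup M] [Module A M] [AddCommGroup N] [Module A N]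
    [Module R' N] [SMulCommClass A R' N] (E : Set (M →ₗ[A] N)) : Prop :=
  ∃ s : Finset (M →ₗ[A] N), ↑s ⊆ E ∧
    ∀ δ ∈ E, ∃ c : (M →ₗ[A] N) → R', δ = ∑ g ∈ s, c g • g

/-- A field extension `L/K` is separable (in the general, not necessarily algebraic, sense)
if `L ⊗[K] K'` is reduced for every field extension `K'/K` (MacLane's criterion). -/
def IsSeparableFieldExtension (K : Type u) (L : Type v) [Field K] [Field L] [Algebra K L] :
    Prop :=
  ∀ (K' : Type u) [Field K'] [Algebra K K'], IsReduced (L ⊗[K] K')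

end NoetherianOps
namespace NoetherianOps

theorem pair_map {R T κ M1 Rp : Type*} [CommRing R] [CommRing T] [Algebra R T] [CommRing Rp]
    [Algebra R Rp] [Field κ] [Algebra R κ] [Algebra Rp κ] [IsScalarTower R Rp κ]
    [AddCommGroup M1] [Module R M1] [Module Rp M1] [IsScalarTower R Rp M1]
    (π : T →ₐ[R] κ) :
    ∃ g : T ⊗[R] M1 →ₗ[R] κ ⊗[Rp] M1, (∀ t m, g (t ⊗ₜ m) = π t ⊗ₜ m) ∧
      ∀ (t : T) z, g (t • z) = π t • g z := by
  let b : T →ₗ[R] M1 →ₗ[R] κ ⊗[Rp] M1 := LinearMap.mk₂ R (fun t m => π t ⊗ₜ[Rp] m)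
    (by intros; simp [TensorProduct.add_tmul]) 
    (by intro c m n; rw [map_smul]; rfl)
    (by intros; simp [TensorProduct.tmul_add]) 
    (by intro c m n
        rw [← algebraMap_smul Rp c n, TensorProduct.tmul_smul, algebraMap_smul])
  refine ⟨TensorProduct.lift b, fun t m => rfl, fun t z => ?_⟩
  induction z with
  | zero => simp
  | add x y hx hy => simp only [smul_add, map_add, hx, hy]
  | tmul s m =>
    change π (t * s) ⊗ₜ[Rp] m = π t • (π s ⊗ₜ[Rp] m)
    rw [map_mul]; rfl

theorem artin_rees_step {R T κ M : Type*} [CommRing R] [IsNoetherianRing R]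
    [CommRing T] [IsNoetherianRing T] [Algebra R T] [Module.Flat R T]
    (p : Ideal R) [p.IsPrime] [Field κ] [Algebra R κ] [Algebra (R ⧸ p) κ]
    [IsScalarTower R (R ⧸ p) κ] [IsFractionRing (R ⧸ p) κ] (π : T →ₐ[R] κ)
    [AddCommGroup M] [Module R M] [Module.Finite R M] (hass : associatedPrimes R M = {p}) :
    ∃ n : ℕ, ∀ m : M, (1 : T) ⊗ₜ[R] m ∈
      (RingHom.ker π) ^ n • (⊤ : Submodule T (T ⊗[R] M)) → m = 0 := by
  set I : Ideal T := RingHom.ker π with hI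
  let M1 : Submodule R M := Submodule.torsionBySet R M (p : Set R)
  let ι : T ⊗[R] M1 →ₗ[T] T ⊗[R] M := M1.subtype.baseChange T
  have hι : Function.Injective ι :=
    Module.Flat.lTensor_preserves_injective_linearMap (M := T) M1.subtype M1.subtype_injective
  obtain ⟨k, hk⟩ := Ideal.exists_pow_inf_eq_pow_smul I (LinearMap.range ι)
  refine ⟨k + 1, fun m hm => ?_⟩
  by_contra hm0
  let N : Submodule R M := Submodule.comap (TensorProduct.mk R T M 1)
    ((I ^ (k + 1) • (⊤ : Submodule T (T ⊗[R] M))).restrictScalars R)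
  have hmN : m ∈ N := hm
  obtain ⟨P, hP, -⟩ := exists_le_isAssociatedPrime_of_isNoetherianRing R (⟨m, hmN⟩ : N)
    (fun h => hm0 (congrArg Subtype.val h))
  have hPp : P = p := by
    have : P ∈ associatedPrimes R M :=
      associatedPrimes.subset_of_injective N.subtype_injective hP
    rwa [hass] at this
  subst hPp
  rw [isAssociatedPrime_iff] at hP
  obtain ⟨-, ⟨e, heN⟩, he⟩ := hP
  have he' : ∀ r : R, r ∈ P ↔ r • e = 0 := by
    intro r
    rw [he, Submodule.mem_colon_singleton, Submodule.mem_bot, ← Subtype.coe_inj]; rfl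
  have heM1 : e ∈ M1 := by
    rw [Submodule.mem_torsionBySet_iff]
    rintro ⟨a, ha⟩
    exact (he' a).1 ha
  have h1 : (1 : T) ⊗ₜ[R] (⟨e, heM1⟩ : M1) ∈ I • (⊤ : Submodule T (T ⊗[R] M1)) := by
    have h2 : ι ((1 : T) ⊗ₜ[R] (⟨e, heM1⟩ : M1)) ∈
        I ^ (k + 1) • (⊤ : Submodule T (T ⊗[R] M)) ⊓ LinearMap.range ι :=
      ⟨heN, LinearMap.mem_range_self _ _⟩
    rw [hk (k + 1) (by omega)] at h2
    have h3 : I ^ (k + 1 - k) • (I ^ k • ⊤ ⊓ LinearMap.range ι) ≤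
        Submodule.map ι (I • ⊤) := by
      rw [Submodule.map_smul'', Submodule.map_top, Nat.add_sub_cancel_left, pow_one]
      exact Submodule.smul_mono le_rfl inf_le_right
    obtain ⟨z, hz, hz'⟩ := h3 h2
    rw [← hι hz']; exact hz
  obtain ⟨g, hg1, hg2⟩ := pair_map (M1 := M1) (Rp := R ⧸ P) π
  have h0 : g ((1 : T) ⊗ₜ[R] (⟨e, heM1⟩ : M1)) = 0 := by
    refine Submodule.smul_induction_on h1 (fun r hr n _ => ?_) (fun x y hx hy => ?_)
    · rw [hg2, show π r = 0 from hr, zero_smul]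
    · rw [map_add, hx, hy, add_zero]
  rw [hg1, map_one] at h0
  have : Module.Flat (R ⧸ P) κ := IsLocalization.flat κ (nonZeroDivisors (R ⧸ P))
  have hinj : Function.Injective (LinearMap.toSpanSingleton (R ⧸ P) M1 ⟨e, heM1⟩) := by
    rw [injective_iff_map_eq_zero]
    intro a ha
    obtain ⟨r, rfl⟩ := Ideal.Quotient.mk_surjective a
    rw [Ideal.Quotient.eq_zero_iff_mem, he']
    exact congrArg Subtype.val ha
  have := Module.Flat.lTensor_preserves_injective_linearMap (M := κ) _ hinj
  have h5 : (1 : κ) ⊗ₜ[R ⧸ P] (1 : R ⧸ P) = 0 := by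
    apply this
    rw [LinearMap.lTensor_tmul, map_zero, LinearMap.toSpanSingleton_apply, one_smul, h0]
  have h6 := congrArg (TensorProduct.rid (R ⧸ P) κ) h5
  simp at h6

/-- functional -/
theorem exists_functional {T κ Q : Type*} [CommRing T] [Field κ] [AddCommGroup Q] [Module T Q]
    (j : κ →+* T) (N : Submodule T Q) (q : Q) (hq : q ∉ N) :
    ∃ l : Q →+ κ, (∀ c x, l (j c • x) = c * l x) ∧ (∀ x ∈ N, l x = 0) ∧ l q ≠ 0 := by
  letI : Module κ (Q ⧸ N) := Module.compHom _ j
  have hne : N.mkQ q ≠ 0 := by simpa using hq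
  obtain ⟨f, hf⟩ : ∃ f : Module.Dual κ (Q ⧸ N), f (N.mkQ q) ≠ 0 := by
    by_contra! h
    exact hne ((Module.forall_dual_apply_eq_zero_iff κ _).1 h)
  refine ⟨f.toAddMonoidHom.comp N.mkQ.toAddMonoidHom, fun c x => ?_, fun x hx => ?_, hf⟩
  · change f (N.mkQ (j c • x)) = _
    rw [map_smul]
    exact f.map_smul c (N.mkQ x)
  · change f (N.mkQ x) = 0
    rw [(Submodule.Quotient.mk_eq_zero N).2 hx |> (show N.mkQ x = 0 from ·), map_zero]
end NoetherianOps
namespace NoetherianOps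

section DiffLemmas

variable {A R F : Type*} [CommRing A] [CommRing R] [Algebra A R]
  [AddCommGroup F] [Module A F] [Module R F] [IsScalarTower A R F]

theorem zero_mem_diffLE (n : ℕ) : (0 : F →ₗ[A] R) ∈ DiffLE A R F R n := by
  induction n with
  | zero => intro r; ext m; simp
  | succ n ih =>
    intro r
    have : opBracket A R F R r 0 = 0 := by ext m; simp
    rw [this]; exact ih

theorem add_mem_diffLE (n : ℕ) : ∀ {δ ε : F →ₗ[A] R}, δ ∈ DiffLE A R F R n →
    ε ∈ DiffLE A R F R n → δ + ε ∈ DiffLE A R F R n := by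
  have key : ∀ (r : R) (δ ε : F →ₗ[A] R),
      opBracket A R F R r (δ + ε) = opBracket A R F R r δ + opBracket A R F R r ε := by
    intro r δ ε; ext m; simp; ring
  induction n with
  | zero => intro δ ε hδ hε r; rw [key, hδ r, hε r, add_zero]
  | succ n ih => intro δ ε hδ hε r; rw [key]; exact ih (hδ r) (hε r)

theorem smul_mem_diffLE (n : ℕ) (c : R) : ∀ {δ : F →ₗ[A] R}, δ ∈ DiffLE A R F R n →
    c • δ ∈ DiffLE A R F R n := by
  have key : ∀ (r : R) (δ : F →ₗ[A] R),
      opBracket A R F R r (c • δ) = c • opBracket A R F R r δ := by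
    intro r δ; ext m; simp; ring
  induction n with
  | zero => intro δ hδ r; rw [key, hδ r, smul_zero]
  | succ n ih => intro δ hδ r; rw [key]; exact ih (hδ r)

theorem preSMul_mem_diffLE (n : ℕ) (c : R) : ∀ {δ : F →ₗ[A] R}, δ ∈ DiffLE A R F R n →
    preSMul A R F R c δ ∈ DiffLE A R F R n := by
  have key : ∀ (r : R) (δ : F →ₗ[A] R),
      opBracket A R F R r (preSMul A R F R c δ) = preSMul A R F R c (opBracket A R F R r δ) := by
    intro r δ; ext m; simp [smul_comm c r m]
  induction n with
  | zero =>
    intro δ hδ r; rw [key, hδ r]; ext m; simp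
  | succ n ih => intro δ hδ r; rw [key]; exact ih (hδ r)

/-- Precomposition of an operator on `R` with an `R`-linear functional. -/
theorem comp_mem_diffLE (n : ℕ) (l : F →ₗ[R] R) : ∀ {δ : R →ₗ[A] R}, δ ∈ DiffLE A R R R n →
    δ.comp (l.restrictScalars A) ∈ DiffLE A R F R n := by
  have key : ∀ (r : R) (δ : R →ₗ[A] R),
      opBracket A R F R r (δ.comp (l.restrictScalars A)) =
        (opBracket A R R R r δ).comp (l.restrictScalars A) := by
    intro r δ; ext m; simp
  induction n with
  | zero => intro δ hδ r; rw [key, hδ r]; ext m; simp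
  | succ n ih => intro δ hδ r; rw [key]; exact ih (hδ r)

variable (A R F) in
/-- `DiffLE` as a left `R`-submodule. -/
def diffSub (n : ℕ) : Submodule R (F →ₗ[A] R) where
  carrier := DiffLE A R F R n
  add_mem' := add_mem_diffLE n
  zero_mem' := zero_mem_diffLE n
  smul_mem' c _ h := smul_mem_diffLE n c h

theorem exists_finite_determining [Algebra.EssFiniteType A R] [Module.Finite R F] (n : ℕ) :
    ∃ V : Set F, V.Finite ∧ ∀ δ ∈ DiffLE A R F R n, (∀ v ∈ V, δ v = 0) → δ = 0 := by
  obtain ⟨σ, hσ⟩ := (Algebra.essFiniteType_iff A R).1 inferInstance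
  obtain ⟨V0, hV0⟩ := (Module.Finite.fg_top : (⊤ : Submodule R F).FG)
  have base : ∀ δ ∈ DiffLE A R F R 0, (∀ v ∈ V0, δ v = 0) → δ = 0 := by
    intro δ hδ hv
    ext m
    have hm : m ∈ Submodule.span R (V0 : Set F) := hV0 ▸ Submodule.mem_top
    refine Submodule.span_induction (p := fun m _ => δ m = 0) (fun x hx => hv x hx)
      (map_zero δ) (fun x y _ _ hx hy => by rw [map_add, hx, hy, add_zero])
      (fun r x _ hx => ?_) hm
    have := LinearMap.congr_fun (hδ r) x
    simp only [opBracket_apply, LinearMap.zero_apply] at this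
    rw [sub_eq_zero.1 this, hx, smul_zero]
  induction n with
  | zero => exact ⟨V0, V0.finite_toSet, base⟩
  | succ n ih =>
    obtain ⟨V, hVf, hV⟩ := ih
    refine ⟨V0 ∪ (V ∪ ⋃ x ∈ (σ : Set R), (fun v => x • v) '' V), ?_, ?_⟩
    · exact V0.finite_toSet.union
        (hVf.union (σ.finite_toSet.biUnion fun x _ => hVf.image _))
    · intro δ hδ hv
      have h1 : ∀ x ∈ σ, ∀ m, δ (x • m) = x * δ m := by
        intro x hx m
        have : opBracket A R F R x δ = 0 := by
          apply hV _ (hδ x)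
          intro v hvV
          rw [opBracket_apply, hv v (Or.inr (Or.inl hvV)),
            hv (x • v) (Or.inr (Or.inr (Set.mem_biUnion (show x ∈ (σ : Set R) from hx)
              ⟨v, hvV, rfl⟩)))]
          simp
        have := LinearMap.congr_fun this m
        simp only [opBracket_apply, LinearMap.zero_apply, smul_eq_mul] at this
        exact sub_eq_zero.1 this
      have h2 : ∀ x ∈ Algebra.adjoin A (σ : Set R), ∀ m, δ (x • m) = x * δ m := by
        intro x hx
        refine Algebra.adjoin_induction (fun x hx => h1 x hx) (fun a m => ?_)
          (fun x y _ _ hx hy m => ?_) (fun x y _ _ hx hy m => ?_) hx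
        · rw [algebraMap_smul, map_smul, Algebra.smul_def]
        · rw [add_smul, map_add, hx, hy, add_mul]
        · rw [mul_smul, hx, hy, mul_assoc]
      apply base δ
      · intro s
        ext m
        obtain ⟨t, ht, htu, hst⟩ := hσ s
        have h3 := h2 _ hst m
        rw [mul_comm s t, mul_smul, h2 t ht, mul_assoc] at h3
        simp only [opBracket_apply, LinearMap.zero_apply, smul_eq_mul]
        rw [htu.mul_left_cancel h3, sub_self]
      · intro v hv'
        exact hv v (Or.inl hv')

theorem isNoetherian_diffSub [IsNoetherianRing R] [Algebra.EssFiniteType A R] [Module.Finite R F]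
    (n : ℕ) : IsNoetherian R (diffSub A R F n) := by
  obtain ⟨V, hVf, hV⟩ := exists_finite_determining (A := A) (R := R) (F := F) n
  have := hVf.to_subtype
  let ev : diffSub A R F n →ₗ[R] (V → R) :=
    { toFun := fun δ v => δ.1 v.1
      map_add' := fun _ _ => rfl
      map_smul' := fun _ _ => rfl }
  refine isNoetherian_of_injective ev ?_
  rw [injective_iff_map_eq_zero]
  intro δ hδ
  exact Subtype.ext (hV δ.1 δ.2 fun v hv => congrFun hδ ⟨v, hv⟩)

theorem isFGLeft_of_le [IsNoetherianRing R] [Algebra.EssFiniteType A R] [Module.Finite R F]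
    (n : ℕ) (E : Submodule R (F →ₗ[A] R)) (hE : E ≤ diffSub A R F n) :
    IsFGLeft R (E : Set (F →ₗ[A] R)) := by
  have := isNoetherian_diffSub (A := A) (R := R) (F := F) n
  have hN : IsNoetherian R E := isNoetherian_of_injective (Submodule.inclusion hE)
    (Submodule.inclusion_injective hE)
  obtain ⟨s, hs⟩ := (Submodule.fg_top E).1 (hN.noetherian ⊤)
  refine ⟨s, ?_, ?_⟩
  · rw [← hs]; exact Submodule.subset_span
  · intro δ hδ
    have hδ' : δ ∈ Submodule.span R (s : Set (F →ₗ[A] R)) := hs ▸ hδ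
    obtain ⟨c, -, hc⟩ := Submodule.mem_span_finset.1 hδ'
    exact ⟨c, hc.symm⟩

end DiffLemmas

end NoetherianOps
namespace NoetherianOps

section Hasse

variable {A R : Type*} [CommRing A] [CommRing R] [Algebra A R]

theorem kaehler_data (A R : Type*) [CommRing A] [CommRing R] [Algebra A R]
    [Algebra.FormallySmooth A R] [Algebra.EssFiniteType A R] :
    ∃ (d : ℕ) (D : Fin d → Derivation A R R) (w : Fin d → R ⊗[A] R),
      (∀ i, w i ∈ KaehlerDifferential.ideal A R) ∧
      ∀ x : R, ((1 : R) ⊗ₜ[A] x - x ⊗ₜ[A] (1 : R)) - ∑ i, (D i x ⊗ₜ[A] (1 : R)) * w i ∈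
        KaehlerDifferential.ideal A R ^ 2 := by
  obtain ⟨d, f, g, -, -, hfg⟩ :=
    Module.Finite.exists_comp_eq_id_of_projective R (Ω[R⁄A])
  have hw : ∀ i : Fin d, ∃ w : KaehlerDifferential.ideal A R,
      (KaehlerDifferential.ideal A R).toCotangent w = f (Pi.single i 1) := fun i =>
    Ideal.toCotangent_surjective _ _
  choose w hw using hw
  refine ⟨d, fun i => (LinearMap.proj i ∘ₗ g).compDer (KaehlerDifferential.D A R),
    fun i => (w i : R ⊗[A] R), fun i => (w i).2, fun x => ?_⟩
  have h1 : KaehlerDifferential.D A R x =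
      ∑ i, (g (KaehlerDifferential.D A R x) i) • f (Pi.single i 1) := by
    conv_lhs => rw [← LinearMap.id_apply (R := R) (KaehlerDifferential.D A R x), ← hfg]
    rw [LinearMap.comp_apply]
    conv_lhs => rw [pi_eq_sum_univ' (g (KaehlerDifferential.D A R x)), map_sum]
    refine Finset.sum_congr rfl fun i _ => ?_
    rw [map_smul]
  set z : KaehlerDifferential.ideal A R :=
    ⟨(1 : R) ⊗ₜ[A] x - x ⊗ₜ[A] (1 : R), KaehlerDifferential.one_smul_sub_smul_one_mem_ideal A x⟩ with hz
  have h2 : (KaehlerDifferential.ideal A R).toCotangent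
      (z - ∑ i, (g (KaehlerDifferential.D A R x) i ⊗ₜ[A] (1 : R)) • w i) = 0 := by
    rw [map_sub, map_sum, sub_eq_zero]
    refine Eq.trans (KaehlerDifferential.D_apply A R x).symm (h1.trans ?_)
    refine Finset.sum_congr rfl fun i _ => ?_
    rw [map_smul, hw, ← algebraMap_smul (R ⊗[A] R)]
    rfl
  rw [Ideal.toCotangent_eq_zero] at h2
  simpa [hz] using h2

theorem hasse_lift [Algebra.FormallySmooth A R] {d : ℕ} (D : Fin d → Derivation A R R) (N : ℕ) :
    ∃ φ : R →ₐ[A] (MvPolynomial (Fin d) R ⧸ MvPolynomial.idealOfVars (Fin d) R ^ (N + 2)),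
      ∀ x, φ x - Ideal.Quotient.mk _
        (MvPolynomial.C x + ∑ i, MvPolynomial.C (D i x) * MvPolynomial.X i) ∈
        (MvPolynomial.idealOfVars (Fin d) R ^ 2).map (Ideal.Quotient.mk
          (MvPolynomial.idealOfVars (Fin d) R ^ (N + 2))) := by
  set J := MvPolynomial.idealOfVars (Fin d) R with hJ
  have hX : ∀ i, (MvPolynomial.X i : MvPolynomial (Fin d) R) ∈ J := fun i =>
    Ideal.subset_span ⟨i, rfl⟩
  let q : R → MvPolynomial (Fin d) R := fun x =>
    MvPolynomial.C x + ∑ i, MvPolynomial.C (D i x) * MvPolynomial.X i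
  have hs : ∀ x, ∑ i, MvPolynomial.C (D i x) * MvPolynomial.X i ∈ J := fun x =>
    Ideal.sum_mem _ fun i _ => J.mul_mem_left _ (hX i)
  let g : R →ₐ[A] (MvPolynomial (Fin d) R ⧸ J ^ 2) :=
    { toFun := fun x => Ideal.Quotient.mk (J ^ 2) (q x)
      map_one' := by simp [q]
      map_zero' := by simp [q]
      map_add' := by
        intro x y
        rw [← map_add]; congr 1
        simp only [q, map_add, add_mul, Finset.sum_add_distrib]; ring
      map_mul' := by
        intro x y
        rw [← map_mul, eq_comm, Ideal.Quotient.eq]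
        have : q x * q y - q (x * y) =
            (∑ i, MvPolynomial.C (D i x) * MvPolynomial.X i) *
            (∑ i, MvPolynomial.C (D i y) * MvPolynomial.X i) := by
          simp only [q, Derivation.leibniz, smul_eq_mul, map_add, map_mul, add_mul,
            Finset.sum_add_distrib, mul_assoc, ← Finset.mul_sum]
          ring
        rw [this, pow_two]
        exact Ideal.mul_mem_mul (hs x) (hs y)
      commutes' := by
        intro a
        simp only [q, Derivation.map_algebraMap, map_zero, zero_mul, Finset.sum_const_zero,
          add_zero]
        rfl }
  have hle : J ^ (N + 2) ≤ J ^ 2 := Ideal.pow_le_pow_right (by omega)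
  have hker : RingHom.ker (Ideal.Quotient.factorₐ A hle) =
      (J ^ 2).map (Ideal.Quotient.mk (J ^ (N + 2))) := by
    rw [← Ideal.Quotient.factor_ker hle]; rfl
  have hnil : IsNilpotent (RingHom.ker (Ideal.Quotient.factorₐ A hle)) := by
    refine ⟨N + 2, ?_⟩
    rw [hker, ← Ideal.map_pow, Ideal.zero_eq_bot, eq_bot_iff, Ideal.map_le_iff_le_comap, ← pow_mul]
    intro z hz
    rw [Ideal.mem_comap, Ideal.mem_bot, Ideal.Quotient.eq_zero_iff_mem]
    exact Ideal.pow_le_pow_right (by omega) hz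
  have hsurj : Function.Surjective (Ideal.Quotient.factorₐ A hle) :=
    Ideal.Quotient.factor_surjective hle
  refine ⟨Algebra.FormallySmooth.liftOfSurjective g (Ideal.Quotient.factorₐ A hle)
    hsurj hnil, fun x => ?_⟩
  rw [← hker, RingHom.mem_ker, map_sub, sub_eq_zero]
  exact (Algebra.FormallySmooth.liftOfSurjective_apply g _ hsurj hnil x).trans rfl

theorem bijective_of_sub_mem {Q : Type*} [CommRing Q] (J : Ideal Q) (N : ℕ) (hJ : J ^ N = ⊥)
    (θ : Q →+* Q) (hθ : ∀ q, θ q - q ∈ J ^ 2) : Function.Bijective θ := by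
  have hθJ : ∀ q ∈ J, θ q ∈ J := fun q hq => by
    have := J.add_mem (Ideal.pow_le_self (by norm_num) (hθ q)) hq
    rwa [sub_add_cancel] at this
  have key : ∀ k, ∀ q ∈ J ^ k, θ q - q ∈ J ^ (k + 1) := by
    intro k
    induction k with
    | zero => intro q _; exact Ideal.pow_le_pow_right (by omega) (hθ q)
    | succ k ih =>
      intro q hq
      rw [pow_succ] at hq
      refine Submodule.mul_induction_on hq (fun a ha b hb => ?_) (fun x y hx hy => ?_)
      · have : θ (a * b) - a * b = (θ a - a) * θ b + a * (θ b - b) := by rw [map_mul]; ring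
        rw [this]
        refine add_mem ?_ ?_
        · rw [pow_succ]; exact Ideal.mul_mem_mul (ih a ha) (hθJ b hb)
        · rw [add_assoc, pow_add]; exact Ideal.mul_mem_mul ha (hθ b)
      · have : θ (x + y) - (x + y) = (θ x - x) + (θ y - y) := by rw [map_add]; ring
        rw [this]; exact add_mem hx hy
  constructor
  · rw [injective_iff_map_eq_zero]
    intro q hq
    have : ∀ k, q ∈ J ^ k := by
      intro k
      induction k with
      | zero => simp
      | succ k ih => have := key k q ih; rw [hq, zero_sub] at this; simpa using this
    have := this N
    rwa [hJ] at this
  · intro q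
    have : ∀ k, ∃ b, q - θ b ∈ J ^ k := by
      intro k
      induction k with
      | zero => exact ⟨0, by simp⟩
      | succ k ih =>
        obtain ⟨b, hb⟩ := ih
        refine ⟨b + (q - θ b), ?_⟩
        have := neg_mem (key k _ hb)
        rw [map_add]
        convert this using 1; ring
    obtain ⟨b, hb⟩ := this N
    rw [hJ, Ideal.mem_bot, sub_eq_zero] at hb
    exact ⟨b, hb.symm⟩

theorem diffLE_of_lift {B : Type*} [CommRing B] [Algebra A B] [Algebra R B] [IsScalarTower A R B]
    (J : Ideal B) (φ : R →ₐ[A] B) (hφ : ∀ r, φ r - algebraMap R B r ∈ J) (μ : B →ₗ[R] R) (n : ℕ) :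
    ∀ b : B, (∀ z ∈ J ^ (n + 1), b * z = 0) →
      (μ.restrictScalars A ∘ₗ LinearMap.mulLeft A b ∘ₗ φ.toLinearMap) ∈ DiffLE A R R R n := by
  have key : ∀ (r : R) (b : B), opBracket A R R R r
      (μ.restrictScalars A ∘ₗ LinearMap.mulLeft A b ∘ₗ φ.toLinearMap) =
      (μ.restrictScalars A ∘ₗ LinearMap.mulLeft A (b * (φ r - algebraMap R B r)) ∘ₗ
        φ.toLinearMap) := by
    intro r b
    ext
    simp only [opBracket_apply, LinearMap.comp_apply, LinearMap.restrictScalars_apply,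
      LinearMap.mulLeft_apply, AlgHom.toLinearMap_apply, smul_eq_mul, map_mul]
    rw [← smul_eq_mul r, ← μ.map_smul, ← μ.map_sub, Algebra.smul_def]
    congr 1; ring
  induction n with
  | zero =>
    intro b hb r
    rw [key, hb _ (by simpa using hφ r)]
    ext; simp
  | succ n ih =>
    intro b hb r
    rw [key]
    apply ih
    intro z hz
    rw [mul_assoc]
    apply hb
    rw [pow_succ']
    exact Ideal.mul_mem_mul (hφ r) hz

theorem exists_lift_functional {κ : Type*} (p : Ideal R) [p.IsPrime] [Field κ] [Algebra R κ]
    [Algebra (R ⧸ p) κ] [IsScalarTower R (R ⧸ p) κ] [IsFractionRing (R ⧸ p) κ] {d n : ℕ}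
    (μ : (MvPolynomial (Fin d) R ⧸ MvPolynomial.idealOfVars (Fin d) R ^ n) →ₗ[R] κ) :
    ∃ s : R, s ∉ p ∧
      ∃ μ' : (MvPolynomial (Fin d) R ⧸ MvPolynomial.idealOfVars (Fin d) R ^ n) →ₗ[R] R,
      ∀ b, algebraMap R κ (μ' b) = algebraMap R κ s * μ b := by
  classical
  have hfin : {α : Fin d →₀ ℕ | α.degree < n}.Finite := by
    refine (Finsupp.finite_of_degree_le n).subset fun α (hα : α.degree < n) =>
      (show α.degree ≤ n from hα.le)
  let S : Finset κ := hfin.toFinset.image fun α =>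
    μ (Ideal.Quotient.mk (MvPolynomial.idealOfVars (Fin d) R ^ n) (MvPolynomial.monomial α 1))
  obtain ⟨⟨b, hb⟩, hbS⟩ :=
    IsLocalization.exist_integer_multiples_of_finset (nonZeroDivisors (R ⧸ p)) S
  obtain ⟨s, rfl⟩ := Ideal.Quotient.mk_surjective b
  have hc : ∀ α : Fin d →₀ ℕ, ∃ c : R, if α.degree < n then algebraMap R κ c =
      algebraMap R κ s * μ (Ideal.Quotient.mk (MvPolynomial.idealOfVars (Fin d) R ^ n) (MvPolynomial.monomial α 1)) else c = 0 := by
    intro α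
    split_ifs with h
    · obtain ⟨a, ha⟩ := hbS (μ (Ideal.Quotient.mk (MvPolynomial.idealOfVars (Fin d) R ^ n) (MvPolynomial.monomial α 1)))
        (Finset.mem_image_of_mem _ (by simpa using h))
      obtain ⟨c, rfl⟩ := Ideal.Quotient.mk_surjective a
      refine ⟨c, ?_⟩
      rw [IsScalarTower.algebraMap_apply R (R ⧸ p) κ, IsScalarTower.algebraMap_apply R (R ⧸ p) κ]
      refine ha.trans ?_
      rw [Algebra.smul_def]; rfl
    · exact ⟨0, rfl⟩
  choose c hc using hc
  let m0 : MvPolynomial (Fin d) R →ₗ[R] R := (MvPolynomial.basisMonomials (Fin d) R).constr R c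
  have hm0 : ∀ α, m0 (MvPolynomial.monomial α 1) = c α := by
    intro α
    have := (MvPolynomial.basisMonomials (Fin d) R).constr_basis R c α
    rwa [MvPolynomial.coe_basisMonomials] at this
  have hm0' : ∀ f : MvPolynomial (Fin d) R, m0 f = ∑ α ∈ f.support, f.coeff α * c α := by
    intro f
    conv_lhs => rw [f.as_sum, map_sum]
    refine Finset.sum_congr rfl fun α _ => ?_
    rw [← hm0, ← smul_eq_mul, ← map_smul, MvPolynomial.smul_monomial, smul_eq_mul, mul_one]
  have hkill : (MvPolynomial.idealOfVars (Fin d) R ^ n).restrictScalars R ≤ LinearMap.ker m0 := by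
    intro f hf
    rw [LinearMap.mem_ker, hm0']
    refine Finset.sum_eq_zero fun α hα => ?_
    have h1 := (MvPolynomial.mem_pow_idealOfVars_iff n f).1 hf α hα
    have h2 := hc α
    rw [if_neg (by omega)] at h2
    rw [h2, mul_zero]
  let m1 : (MvPolynomial (Fin d) R ⧸ MvPolynomial.idealOfVars (Fin d) R ^ n) →ₗ[R] R :=
    (((MvPolynomial.idealOfVars (Fin d) R ^ n).restrictScalars R).liftQ m0 hkill) ∘ₗ
      (Submodule.Quotient.restrictScalarsEquiv R (MvPolynomial.idealOfVars (Fin d) R ^ n)).symm.toLinearMap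
  have hm1 : ∀ f, m1 (Ideal.Quotient.mk (MvPolynomial.idealOfVars (Fin d) R ^ n) f) = m0 f := fun f => rfl
  refine ⟨s, fun hs => ?_, m1, ?_⟩
  · rw [Ideal.Quotient.eq_zero_iff_mem.2 hs] at hb
    exact zero_notMem_nonZeroDivisors hb
  · intro b
    obtain ⟨f, rfl⟩ := Ideal.Quotient.mk_surjective b
    rw [hm1]
    have hmono : ∀ α, algebraMap R κ (c α) = algebraMap R κ s *
        μ (Ideal.Quotient.mk (MvPolynomial.idealOfVars (Fin d) R ^ n) (MvPolynomial.monomial α 1)) := by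
      intro α
      have h2 := hc α
      split_ifs at h2 with h
      · exact h2
      · have : Ideal.Quotient.mk (MvPolynomial.idealOfVars (Fin d) R ^ n) (MvPolynomial.monomial α (1 : R)) = 0 := by
          rw [Ideal.Quotient.eq_zero_iff_mem]
          refine (MvPolynomial.mem_pow_idealOfVars_iff n _).2 fun x hx => ?_
          have := MvPolynomial.support_monomial_subset hx
          rw [Finset.mem_singleton] at this
          subst this; omega
        rw [h2, this, map_zero, map_zero, mul_zero]
    have hlin : ∀ (a : R) (g : MvPolynomial (Fin d) R),
        μ (Ideal.Quotient.mk (MvPolynomial.idealOfVars (Fin d) R ^ n) (a • g)) = algebraMap R κ a * μ (Ideal.Quotient.mk (MvPolynomial.idealOfVars (Fin d) R ^ n) g) := by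
      intro a g
      rw [← Algebra.smul_def, ← map_smul]; rfl
    rw [hm0']
    conv_rhs => rw [f.as_sum, map_sum, map_sum, Finset.mul_sum]
    rw [map_sum]
    refine Finset.sum_congr rfl fun α _ => ?_
    rw [map_mul, hmono, show MvPolynomial.monomial α (f.coeff α) =
      f.coeff α • MvPolynomial.monomial α (1 : R) by
        rw [MvPolynomial.smul_monomial, smul_eq_mul, mul_one], hlin]
    ring

end Hasse

end NoetherianOps
namespace NoetherianOps

section Rep

theorem map_pow_eq_bot {T : Type*} [CommRing T] (I : Ideal T) (n : ℕ) :
    (I.map (Ideal.Quotient.mk (I ^ n))) ^ n = ⊥ := by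
  rw [← Ideal.map_pow, Ideal.map_quotient_self]

theorem exists_operator {A R κ : Type*} [CommRing A] [CommRing R] [Algebra A R]
    [Algebra.FormallySmooth A R] [Algebra.EssFiniteType A R]
    (p : Ideal R) [p.IsPrime] [Field κ] [Algebra A κ] [Algebra R κ] [IsScalarTower A R κ]
    [Algebra (R ⧸ p) κ] [IsScalarTower R (R ⧸ p) κ] [IsFractionRing (R ⧸ p) κ] (N : ℕ)
    (π : R ⊗[A] κ →ₐ[R] κ) (hπ : ∀ r c, π (r ⊗ₜ c) = algebraMap R κ r * c)
    (Λ : R ⊗[A] κ →+ κ) (hΛ : ∀ c z, Λ (((1 : R) ⊗ₜ[A] c) * z) = c * Λ z)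
    (hΛI : ∀ z ∈ RingHom.ker π ^ (N + 2), Λ z = 0) :
    ∃ s : R, s ∉ p ∧ ∃ δ ∈ DiffLE A R R R (N + 1), ∀ x : R,
      algebraMap R κ (δ x) = algebraMap R κ s * Λ (x ⊗ₜ[A] (1 : κ)) := by
  obtain ⟨d, D, w, hw, hD⟩ := kaehler_data A R
  obtain ⟨φ, hφ⟩ := hasse_lift D N
  set I : Ideal (R ⊗[A] κ) := RingHom.ker π with hI
  let mk : R ⊗[A] κ →+* (R ⊗[A] κ ⧸ I ^ (N + 2)) := Ideal.Quotient.mk (I ^ (N + 2))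
  have hmks : Function.Surjective mk := Ideal.Quotient.mk_surjective
  let IQ : Ideal (R ⊗[A] κ ⧸ I ^ (N + 2)) := I.map mk
  have hIQ : IQ ^ (N + 2) = ⊥ := map_pow_eq_bot I (N + 2)
  have hIQ2 : ∀ z ∈ I ^ 2, mk z ∈ IQ ^ 2 := fun z hz => by
    rw [← Ideal.map_pow]; exact Ideal.mem_map_of_mem _ hz
  let jT : κ →ₐ[A] R ⊗[A] κ := Algebra.TensorProduct.includeRight
  let ρ : R ⊗[A] R →ₐ[A] R ⊗[A] κ := Algebra.TensorProduct.lift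
    (jT.comp (IsScalarTower.toAlgHom A R κ)) Algebra.TensorProduct.includeLeft
    (fun _ _ => Commute.all _ _)
  have hρ : ∀ a b : R, ρ (a ⊗ₜ b) = b ⊗ₜ[A] algebraMap R κ a := by
    intro a b
    change ((1 : R) ⊗ₜ[A] algebraMap R κ a) * (b ⊗ₜ[A] (1 : κ)) = _
    rw [Algebra.TensorProduct.tmul_mul_tmul, one_mul, mul_one]
  have hπρ : ∀ z, π (ρ z) = algebraMap R κ (Algebra.TensorProduct.lmul' A z) := by
    intro z
    induction z with
    | zero => simp
    | add x y hx hy => simp only [map_add, hx, hy]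
    | tmul a b => rw [hρ, hπ, Algebra.TensorProduct.lmul'_apply_tmul, map_mul, mul_comm]
  have hρI : ∀ z ∈ KaehlerDifferential.ideal A R, ρ z ∈ I := by
    intro z hz
    rw [hI, RingHom.mem_ker]
    refine (hπρ z).trans ?_
    rw [show Algebra.TensorProduct.lmul' A z = 0 from hz, map_zero]
  have hρI2 : ∀ z ∈ KaehlerDifferential.ideal A R ^ 2, ρ z ∈ I ^ 2 := by
    intro z hz
    have h1 : (KaehlerDifferential.ideal A R).map ρ ≤ I := Ideal.map_le_iff_le_comap.2 hρI
    have h2 := Ideal.mem_map_of_mem ρ hz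
    rw [Ideal.map_pow] at h2
    exact Ideal.pow_right_mono h1 2 h2
  have hDρ : ∀ x : R, (x ⊗ₜ[A] (1 : κ) - (1 : R) ⊗ₜ[A] algebraMap R κ x) -
      ∑ i, ((1 : R) ⊗ₜ[A] algebraMap R κ (D i x)) * ρ (w i) ∈ I ^ 2 := by
    intro x
    have := hρI2 _ (hD x)
    simpa only [map_sub, map_sum, map_mul, hρ, map_one] using this
  let jR : R →+* R ⊗[A] κ := jT.toRingHom.comp (algebraMap R κ)
  let ev0 : MvPolynomial (Fin d) R →+* (R ⊗[A] κ ⧸ I ^ (N + 2)) :=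
    MvPolynomial.eval₂Hom (mk.comp jR) (fun i => mk (ρ (w i)))
  have hev0 : (MvPolynomial.idealOfVars (Fin d) R).map ev0 ≤ IQ := by
    rw [MvPolynomial.idealOfVars, Ideal.map_span, Ideal.span_le]
    rintro _ ⟨_, ⟨i, rfl⟩, rfl⟩
    have : ev0 (MvPolynomial.X i) = mk (ρ (w i)) := MvPolynomial.eval₂Hom_X' _ _ _
    rw [this]
    exact Ideal.mem_map_of_mem _ (hρI _ (hw i))
  have hev0p : ∀ k, ∀ z ∈ MvPolynomial.idealOfVars (Fin d) R ^ k, ev0 z ∈ IQ ^ k := by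
    intro k z hz
    have h2 := Ideal.mem_map_of_mem ev0 hz
    rw [Ideal.map_pow] at h2
    exact Ideal.pow_right_mono hev0 k h2
  let ev : (MvPolynomial (Fin d) R ⧸ MvPolynomial.idealOfVars (Fin d) R ^ (N + 2)) →+*
      (R ⊗[A] κ ⧸ I ^ (N + 2)) := Ideal.Quotient.lift _ ev0 (fun z hz => by
        have := hev0p _ z hz
        rwa [hIQ] at this)
  have hev : ∀ f, ev (Ideal.Quotient.mk _ f) = ev0 f := fun f => rfl
  have hevC : ∀ r, ev0 (MvPolynomial.C r) = mk ((1 : R) ⊗ₜ[A] algebraMap R κ r) := fun r =>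
    MvPolynomial.eval₂Hom_C _ _ _
  have hevX : ∀ i, ev0 (MvPolynomial.X i) = mk (ρ (w i)) := fun i =>
    MvPolynomial.eval₂Hom_X' _ _ _
  let h : R →ₐ[A] (R ⊗[A] κ ⧸ I ^ (N + 2)) :=
    { toRingHom := ev.comp φ.toRingHom
      commutes' := by
        intro a
        change ev (φ (algebraMap A R a)) = mk (algebraMap A (R ⊗[A] κ) a)
        rw [φ.commutes]
        refine (hevC (algebraMap A R a)).trans ?_
        rw [← IsScalarTower.algebraMap_apply A R κ, ← jT.commutes a]
        rfl }
  have hh : ∀ x, h x - mk (x ⊗ₜ[A] (1 : κ)) ∈ IQ ^ 2 := by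
    intro x
    have h1 : ev (φ x - Ideal.Quotient.mk _
        (MvPolynomial.C x + ∑ i, MvPolynomial.C (D i x) * MvPolynomial.X i)) ∈ IQ ^ 2 := by
      have h3 : (MvPolynomial.idealOfVars (Fin d) R ^ 2).map (Ideal.Quotient.mk
          (MvPolynomial.idealOfVars (Fin d) R ^ (N + 2))) ≤ (IQ ^ 2).comap ev := by
        rw [Ideal.map_le_iff_le_comap]
        intro z hz
        exact hev0p 2 z hz
      exact h3 (hφ x)
    have h2 := hIQ2 _ (hDρ x)
    rw [map_sub, hev] at h1
    simp only [map_add, map_sum, map_mul, hevC, hevX] at h1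
    simp only [map_sub, map_sum, map_mul] at h2
    have := sub_mem h1 h2
    convert this using 1
    change ev (φ x) - _ = _
    ring
  let θ : R ⊗[A] κ →ₐ[A] (R ⊗[A] κ ⧸ I ^ (N + 2)) := Algebra.TensorProduct.lift h
    ((Ideal.Quotient.mkₐ A (I ^ (N + 2))).comp jT) (fun _ _ => Commute.all _ _)
  have hθt : ∀ r c, θ (r ⊗ₜ c) = h r * mk ((1 : R) ⊗ₜ[A] c) := fun r c => rfl
  have hθ : ∀ z, θ z - mk z ∈ IQ ^ 2 := by
    intro z
    induction z with
    | zero => rw [map_zero, map_zero, sub_zero]; exact zero_mem _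
    | add x y hx hy =>
      rw [map_add, map_add, add_sub_add_comm]; exact add_mem hx hy
    | tmul r c =>
      have : mk (r ⊗ₜ c) = mk (r ⊗ₜ[A] (1 : κ)) * mk ((1 : R) ⊗ₜ[A] c) := by
        rw [← map_mul, Algebra.TensorProduct.tmul_mul_tmul, one_mul, mul_one]
      rw [hθt, this, ← sub_mul]
      exact Ideal.mul_mem_right _ _ (hh r)
  have hθI : I.map θ ≤ IQ := by
    rw [Ideal.map_le_iff_le_comap]
    intro z hz
    have := IQ.add_mem (Ideal.pow_le_self (by norm_num) (hθ z)) (Ideal.mem_map_of_mem mk hz)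
    rwa [sub_add_cancel] at this
  let θ' : (R ⊗[A] κ ⧸ I ^ (N + 2)) →+* (R ⊗[A] κ ⧸ I ^ (N + 2)) :=
    Ideal.Quotient.lift _ θ.toRingHom (fun z hz => by
      have h2 := Ideal.mem_map_of_mem θ hz
      rw [Ideal.map_pow] at h2
      have := Ideal.pow_right_mono hθI (N + 2) h2
      rwa [hIQ] at this)
  have hθ'mk : ∀ z, θ' (mk z) = θ z := fun z => rfl
  have hbij : Function.Bijective θ' := by
    refine bijective_of_sub_mem IQ (N + 2) hIQ θ' fun q => ?_
    obtain ⟨z, rfl⟩ := hmks q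
    exact hθ z
  let e := RingEquiv.ofBijective θ' hbij
  have he : ∀ q, e q = θ' q := fun q => rfl
  have hj : ∀ c, e (mk ((1 : R) ⊗ₜ[A] c)) = mk ((1 : R) ⊗ₜ[A] c) := by
    intro c
    rw [he, hθ'mk, hθt, map_one, one_mul]
  have hesymm : ∀ c q, e.symm (mk ((1 : R) ⊗ₜ[A] c) * q) = mk ((1 : R) ⊗ₜ[A] c) * e.symm q := by
    intro c q
    rw [map_mul, ← hj, e.symm_apply_apply, hj]
  let L : (R ⊗[A] κ ⧸ I ^ (N + 2)) → κ := fun q => Λ (Function.surjInv hmks q)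
  have hL : ∀ z, L (mk z) = Λ z := by
    intro z
    have h1 : mk (Function.surjInv hmks (mk z)) = mk z := Function.surjInv_eq hmks _
    have h2 := hΛI _ (Ideal.Quotient.eq.1 h1)
    rw [map_sub, sub_eq_zero] at h2
    exact h2
  have hLadd : ∀ x y, L (x + y) = L x + L y := by
    intro x y
    obtain ⟨x, rfl⟩ := hmks x
    obtain ⟨y, rfl⟩ := hmks y
    rw [← map_add, hL, hL, hL, map_add]
  have hLmul : ∀ c x, L (mk ((1 : R) ⊗ₜ[A] c) * x) = c * L x := by
    intro c x
    obtain ⟨x, rfl⟩ := hmks x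
    rw [← map_mul, hL, hL, hΛ]
  let μ : (MvPolynomial (Fin d) R ⧸ MvPolynomial.idealOfVars (Fin d) R ^ (N + 2)) →ₗ[R] κ :=
    { toFun := fun b => L (e.symm (ev b))
      map_add' := fun x y => by rw [map_add, map_add, hLadd]
      map_smul' := fun r b => by
        have : ev (r • b) = mk ((1 : R) ⊗ₜ[A] algebraMap R κ r) * ev b := by
          obtain ⟨f, rfl⟩ := Ideal.Quotient.mk_surjective b
          change ev (Ideal.Quotient.mk _ (r • f)) = _
          rw [hev, hev, MvPolynomial.smul_eq_C_mul, map_mul, hevC]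
        rw [this, hesymm, hLmul, RingHom.id_apply, Algebra.smul_def] }
  obtain ⟨s, hs, μ', hμ'⟩ := exists_lift_functional p μ
  refine ⟨s, hs, _, diffLE_of_lift ((MvPolynomial.idealOfVars (Fin d) R).map
    (Ideal.Quotient.mk (MvPolynomial.idealOfVars (Fin d) R ^ (N + 2)))) φ (fun r => ?_) μ' (N + 1)
    1 (fun z hz => ?_), fun x => ?_⟩
  · have h1 := hφ r
    rw [Ideal.map_pow] at h1
    have h1 := Ideal.pow_le_self (by norm_num) h1
    have h2 : ∑ i, MvPolynomial.C (D i r) * MvPolynomial.X i ∈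
        MvPolynomial.idealOfVars (Fin d) R :=
      Ideal.sum_mem _ fun i _ => Ideal.mul_mem_left _ _ (Ideal.subset_span ⟨i, rfl⟩)
    have h3 := add_mem h1 (Ideal.mem_map_of_mem (Ideal.Quotient.mk
      (MvPolynomial.idealOfVars (Fin d) R ^ (N + 2))) h2)
    rw [map_add] at h3
    convert h3 using 1
    rw [show algebraMap R (MvPolynomial (Fin d) R ⧸
      MvPolynomial.idealOfVars (Fin d) R ^ (N + 2)) r =
        Ideal.Quotient.mk _ (MvPolynomial.C r) from rfl]
    ring
  · have := map_pow_eq_bot (MvPolynomial.idealOfVars (Fin d) R) (N + 2)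
    rw [add_assoc, one_add_one_eq_two, this] at hz
    rw [Ideal.mem_bot.1 hz, mul_zero]
  · change algebraMap R κ (μ' (1 * φ x)) = _
    rw [one_mul, hμ']
    congr 1
    change L (e.symm (ev (φ x))) = _
    rw [← hL]
    congr 1
    rw [RingEquiv.symm_apply_eq, he, hθ'mk, hθt]
    change h x = _
    rw [← Algebra.TensorProduct.one_def, map_one, mul_one]

end Rep

end NoetherianOps
namespace NoetherianOps

section Assembly

theorem exists_finset_sum {A R F κ ι : Type*} [CommRing A] [CommRing R] [Algebra A R]
    [AddCommGroup F] [Module A F] [Module R F] [IsScalarTower A R F]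
    (p : Ideal R) [p.IsPrime] [CommRing κ] [Algebra R κ] (n : ℕ) (S : Finset ι) (g : ι → F → κ)
    (hg : ∀ i, ∃ s : R, s ∉ p ∧ ∃ δ ∈ DiffLE A R F R n, ∀ f,
      algebraMap R κ (δ f) = algebraMap R κ s * g i f) :
    ∃ s : R, s ∉ p ∧ ∃ δ ∈ DiffLE A R F R n, ∀ f,
      algebraMap R κ (δ f) = algebraMap R κ s * ∑ i ∈ S, g i f := by
  classical
  induction S using Finset.induction_on with
  | empty =>
    exact ⟨1, (Ideal.ne_top_iff_one p).1 (Ideal.IsPrime.ne_top inferInstance), 0,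
      zero_mem_diffLE n, fun f => by simp⟩
  | insert i S hi ih =>
    obtain ⟨s, hs, δ, hδ, h⟩ := ih
    obtain ⟨t, ht, ε, hε, k⟩ := hg i
    refine ⟨s * t, fun hst => (Ideal.IsPrime.mem_or_mem inferInstance hst).elim hs ht,
      s • ε + t • δ, add_mem_diffLE n (smul_mem_diffLE n s hε) (smul_mem_diffLE n t hδ),
      fun f => ?_⟩
    rw [Finset.sum_insert hi]
    simp only [LinearMap.add_apply, LinearMap.smul_apply, smul_eq_mul, map_add, map_mul, h, k]
    ring

theorem exists_separating {A R κ F : Type*} [CommRing A] [CommRing R] [Algebra A R]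
    [IsNoetherianRing R]
    [Algebra.FormallySmooth A R] [Algebra.EssFiniteType A R]
    (p : Ideal R) [p.IsPrime] [Field κ] [Algebra A κ] [Algebra R κ] [IsScalarTower A R κ]
    [Algebra (R ⧸ p) κ] [IsScalarTower R (R ⧸ p) κ] [IsFractionRing (R ⧸ p) κ]
    [AddCommGroup F] [Module R F] [Module A F] [IsScalarTower A R F]
    [Module.Free R F] [Module.Finite R F] (U : Submodule R F) (N : ℕ)
    (π : R ⊗[A] κ →ₐ[R] κ) (hπ : ∀ r c, π (r ⊗ₜ c) = algebraMap R κ r * c)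
    (f : F) (hf : (1 : R ⊗[A] κ) ⊗ₜ[R] (U.mkQ f) ∉ (RingHom.ker π) ^ (N + 2) •
      (⊤ : Submodule (R ⊗[A] κ) ((R ⊗[A] κ) ⊗[R] (F ⧸ U)))) :
    ∃ δ ∈ DiffLE A R F R (N + 1), (∀ u ∈ U, algebraMap R κ (δ u) = 0) ∧
      algebraMap R κ (δ f) ≠ 0 := by
  obtain ⟨l, hl, hlN, hlf⟩ := exists_functional
    (Algebra.TensorProduct.includeRight : κ →ₐ[A] R ⊗[A] κ).toRingHom _ _ hf
  let b := Module.Free.chooseBasis R F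
  let g : Module.Free.ChooseBasisIndex R F → F → κ := fun i x =>
    l (((b.repr x i) ⊗ₜ[A] (1 : κ)) • ((1 : R ⊗[A] κ) ⊗ₜ[R] (U.mkQ (b i))))
  have hg : ∀ x, ∑ i, g i x = l ((1 : R ⊗[A] κ) ⊗ₜ[R] (U.mkQ x)) := by
    intro x
    conv_rhs => rw [← b.sum_repr x]
    rw [map_sum, TensorProduct.tmul_sum, map_sum]
    refine Finset.sum_congr rfl fun i _ => ?_
    change l _ = l _
    congr 1
    rw [map_smul, TensorProduct.tmul_smul]
    exact algebraMap_smul (R ⊗[A] κ) (b.repr x i) _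
  obtain ⟨s, hs, δ, hδ, h⟩ := exists_finset_sum (A := A) p (N + 1) Finset.univ g (by
    intro i
    let Λ : R ⊗[A] κ →+ κ := l.comp ((LinearMap.toSpanSingleton (R ⊗[A] κ) _
      ((1 : R ⊗[A] κ) ⊗ₜ[R] (U.mkQ (b i)))).toAddMonoidHom)
    have hΛ : ∀ t, Λ t = l (t • ((1 : R ⊗[A] κ) ⊗ₜ[R] (U.mkQ (b i)))) := fun _ => rfl
    obtain ⟨s, hs, δ, hδ, h⟩ := exists_operator p N π hπ Λ (fun c z => by
        rw [hΛ, hΛ, mul_smul]; exact hl c _)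
      (fun z hz => by
        rw [hΛ]; exact hlN _ (Submodule.smul_mem_smul hz Submodule.mem_top))
    exact ⟨s, hs, _, comp_mem_diffLE (N + 1) (b.coord i) hδ, fun x => h _⟩)
  refine ⟨δ, hδ, fun u hu => ?_, ?_⟩
  · rw [h, hg, show U.mkQ u = 0 from (Submodule.Quotient.mk_eq_zero U).2 hu,
      TensorProduct.tmul_zero, map_zero, mul_zero]
  · rw [h, hg]
    refine mul_ne_zero (fun h0 => hs ?_) hlf
    rw [IsScalarTower.algebraMap_apply R (R ⧸ p) κ] at h0
    have := (IsFractionRing.injective (R ⧸ p) κ) (h0.trans (map_zero _).symm)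
    exact Ideal.Quotient.eq_zero_iff_mem.1 this

theorem flat_of_injective (A κ : Type*) [CommRing A] [IsDomain A] [Field κ] [Algebra A κ]
    (h : Function.Injective (algebraMap A κ)) : Module.Flat A κ := by
  haveI : FaithfulSMul A κ := (faithfulSMul_iff_algebraMap_injective A κ).2 h
  letI : Algebra (FractionRing A) κ := FractionRing.liftAlgebra A κ
  haveI : IsScalarTower A (FractionRing A) κ := FractionRing.isScalarTower_liftAlgebra A κ
  haveI : Module.Flat A (FractionRing A) := IsLocalization.flat _ (nonZeroDivisors A)
  exact Module.Flat.trans A (FractionRing A) κ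

theorem noeth_tensor (A R κ : Type*) [CommRing A] [CommRing R] [Algebra A R] [Field κ]
    [Algebra A κ] [Algebra.EssFiniteType A R] : IsNoetherianRing (R ⊗[A] κ) := by
  haveI : IsNoetherianRing (κ ⊗[A] R) := Algebra.EssFiniteType.isNoetherianRing κ _
  exact isNoetherianRing_of_ringEquiv (κ ⊗[A] R) (Algebra.TensorProduct.comm A κ R).toRingEquiv

end Assembly

end NoetherianOps
namespace NoetherianOps

/-- **Noetherian operators in `Diff_{R/A}(F, R)` for primary submodules of a finitely
generated free module, formally smooth case** (Corollary 3.15(i)).  Let `A` be a Noetherian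
integral domain and `R ⊇ A` a Noetherian ring which is a formally smooth `A`-algebra,
essentially of finite type over `A`, let `F` be a finitely generated free `R`-module and `p`
a prime of `R` with `p ∩ A = 0`.  Then every `p`-primary submodule `U` of `F` is
`{f ∈ F ∣ δ f ∈ p for all δ ∈ E}` for some `(R ⊗[A] R)`-submodule `E ⊆ Diff_{R/A}(F, R)`
which is finitely generated for the left (post-composition) `R`-module structure. -/
theorem primary_submodule_eq_sol_formallySmooth
    (A R : Type u) [CommRing A] [CommRing R] [IsDomain A]
    [IsNoetherianRing A] [IsNoetherianRing R] [Algebra A R]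
    (hAR : Function.Injective (algebraMap A R))
    [Algebra.FormallySmooth A R] [Algebra.EssFiniteType A R]
    (p : Ideal R) [p.IsPrime]
    (hpA : ∀ a : A, algebraMap A R a ∈ p → a = 0)
    (F : Type*) [AddCommGroup F] [Module R F] [Module A F] [IsScalarTower A R F]
    [Module.Free R F] [Module.Finite R F]
    (U : Submodule R F) (hUne : U ≠ ⊤)
    (hUprim : associatedPrimes R (F ⧸ U) = {p}) :
    ∃ E : Set (F →ₗ[A] R),
      E ⊆ Diff A R F R ∧ IsTensorSubmodule A R F R E ∧
      (U : Set F) = {f : F | ∀ δ ∈ E, δ f ∈ p} ∧ IsFGLeft R E := by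
  classical
  let κ := p.ResidueField
  have hinj : Function.Injective (algebraMap A κ) := by
    rw [injective_iff_map_eq_zero]
    intro a ha
    rw [IsScalarTower.algebraMap_apply A R κ] at ha
    exact hpA a (Ideal.algebraMap_residueField_eq_zero.1 ha)
  haveI : Module.Flat A κ := flat_of_injective A κ hinj
  haveI : IsNoetherianRing (R ⊗[A] κ) := noeth_tensor A R κ
  let π : R ⊗[A] κ →ₐ[R] κ := Algebra.TensorProduct.lift (Algebra.ofId R κ) (AlgHom.id A κ)
    (fun _ _ => Commute.all _ _)
  have hπ : ∀ r c, π (r ⊗ₜ c) = algebraMap R κ r * c := fun r c => rfl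
  obtain ⟨N, hN⟩ := artin_rees_step (M := F ⧸ U) p π hUprim
  let E : Submodule R (F →ₗ[A] R) :=
    { carrier := {δ | δ ∈ DiffLE A R F R (N + 1) ∧ ∀ u ∈ U, δ u ∈ p}
      add_mem' := fun hx hy => ⟨add_mem_diffLE _ hx.1 hy.1, fun u hu =>
        p.add_mem (hx.2 u hu) (hy.2 u hu)⟩
      zero_mem' := ⟨zero_mem_diffLE _, fun u _ => p.zero_mem⟩
      smul_mem' := fun c _ hx => ⟨smul_mem_diffLE _ c hx.1, fun u hu =>
        p.mul_mem_left c (hx.2 u hu)⟩ }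
  refine ⟨(E : Set _), fun δ hδ => ⟨N + 1, hδ.1⟩, ⟨E.zero_mem, fun _ h _ k => E.add_mem h k,
    fun _ h => E.neg_mem h, fun r _ h => E.smul_mem r h, fun r δ h =>
      ⟨preSMul_mem_diffLE _ r h.1, fun u hu => h.2 _ (U.smul_mem r hu)⟩⟩, ?_,
    isFGLeft_of_le (N + 1) E fun _ h => h.1⟩
  ext f
  refine ⟨fun hf δ hδ => hδ.2 f hf, fun hf => ?_⟩
  by_contra hfU
  obtain ⟨δ, hδ, hδU, hδf⟩ := exists_separating p U N π hπ f (fun hmem => hfU (by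
    have := hN _ (Submodule.smul_mono_left (Ideal.pow_le_pow_right (by omega)) hmem)
    exact (Submodule.Quotient.mk_eq_zero U).1 this))
  exact hδf (Ideal.algebraMap_residueField_eq_zero.2 (hf δ ⟨hδ, fun u hu =>
    Ideal.algebraMap_residueField_eq_zero.1 (hδU u hu)⟩))

end NoetherianOps
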